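/- Let $(W,S)$ be a Coxeter system of type $H_4$ with $S = \{r,s,t,u\}$, $o(rs)=5$, $o(st)=3$, $o(tu)=3$, and all other pairs commuting. Define $\delta \colon S \to W$ by $\delta(r) := rsr$, $\delta(s) := s$, $\delta(t) := \omega t \omega^{-1}$, $\delta(u) := u$, where $\omega = rsrsr\,\omega_2$ and $\omega_2 = tsrsrutsrsrtsrsutsrsr$. Then $\delta$ extends to an automorphism of $W$; in particular $\delta(S)$ is a Coxeter generating set of $W$ of type $H_4$. -/

import Mathlib

/-! ### String rewriting -/

namespace StringRewriting

theorem prod_map_foldr {α G : Type*} [Monoid G] {f : α → G}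
    {g : α → List α → List α}
    (hg : ∀ a w, ((g a w).map f).prod = f a * (w.map f).prod) (v w : List α) :
    ((v.foldr g w).map f).prod = (v.map f).prod * (w.map f).prod := by
  induction v with
  | nil => simp
  | cons a v ih => simp [hg, ih, mul_assoc]

variable {α : Type*} [DecidableEq α]

/-- Prepend the letter `a` to the word `w`, then rewrite at the front of the result with the rules
`R` (pairs consisting of a left-hand and a right-hand side), with recursion depth at most `n`. -/
def push (R : List (List α × List α)) : ℕ → α → List α → List α
  | 0, a, w => a :: w
  | n + 1, a, w =>
    match R.find? (fun p => p.1.isPrefixOf (a :: w)) with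
    | some p => p.2.foldr (push R n) ((a :: w).drop p.1.length)
    | none => a :: w

/-- Rewrite the word `w` from right to left with the rules `R`. -/
def normalize (R : List (List α × List α)) (w : List α) : List α :=
  w.foldr (push R 100) []

/-- Extend the rules `R` by the critical pair which arises from the word `p.1 ++ p.2` when
its prefix `p.1` is rewritten first. -/
def addCriticalPair (R : List (List α × List α)) (p : List α × List α) :
    List (List α × List α) :=
  (normalize R (p.1 ++ p.2), normalize R (normalize R p.1 ++ p.2)) :: R

variable {G : Type*} [Monoid G] {f : α → G} {R : List (List α × List α)}

/-- The rules `R` hold for the family `f` of elements of a monoid. -/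
def IsSound (f : α → G) (R : List (List α × List α)) : Prop :=
  ∀ p ∈ R, (p.1.map f).prod = (p.2.map f).prod

theorem IsSound.prod_map_push (hR : IsSound f R) (n : ℕ) (a : α) (w : List α) :
    ((push R n a w).map f).prod = f a * (w.map f).prod := by
  induction n generalizing a w with
  | zero => simp [push]
  | succ n ih =>
    rw [push]
    split
    · next p hp =>
      obtain ⟨v, hv⟩ := List.isPrefixOf_iff_prefix.mp
        (show p.1.isPrefixOf (a :: w) = true from by simpa using List.find?_some hp)
      rw [← hv, List.drop_left, prod_map_foldr ih, ← hR p (List.mem_of_find?_eq_some hp),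
        ← List.prod_append, ← List.map_append, hv, List.map_cons, List.prod_cons]
    · simp

theorem IsSound.prod_map_normalize (hR : IsSound f R) (w : List α) :
    ((normalize R w).map f).prod = (w.map f).prod := by
  simp [normalize, prod_map_foldr (hR.prod_map_push 100)]

theorem IsSound.prod_map_eq (hR : IsSound f R) {v w : List α}
    (h : normalize R v = normalize R w) : (v.map f).prod = (w.map f).prod := by
  rw [← hR.prod_map_normalize v, h, hR.prod_map_normalize]

theorem IsSound.addCriticalPair (hR : IsSound f R) (p : List α × List α) :
    IsSound f (addCriticalPair R p) := by
  intro q hq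
  obtain rfl | hq := List.mem_cons.mp hq
  · simp [hR.prod_map_normalize]
  · exact hR q hq

theorem IsSound.foldl_addCriticalPair (hR : IsSound f R) (l : List (List α × List α)) :
    IsSound f (l.foldl StringRewriting.addCriticalPair R) := by
  induction l generalizing R with
  | nil => exact hR
  | cons p l ih => exact ih (hR.addCriticalPair p)

end StringRewriting

/-! ### The Coxeter group of type `H₄` -/

namespace CoxeterMatrix.H₄

open StringRewriting

/-- The defining relations of the Coxeter group of type `H₄` as rewriting rules. -/
def basicRules : List (List (Fin 4) × List (Fin 4)) :=
  [([0, 0], []), ([1, 1], []), ([2, 2], []), ([3, 3], []),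
    ([0, 1, 0], [1, 0, 1]), ([0, 2], [2, 0]), ([0, 3], [3, 0]),
    ([1, 2, 1], [2, 1, 2]), ([1, 3], [3, 1]), ([2, 3, 2, 3, 2], [3, 2, 3, 2, 3])]

/-- The defining relations of the Coxeter group of type `H₄` and some consequences, as
rewriting rules. -/
def rules : List (List (Fin 4) × List (Fin 4)) :=
  [([0, 1, 2, 3, 2, 3, 1, 2, 3, 0, 1, 2, 3, 2, 3], [1, 0, 1, 2, 3, 2, 3, 1, 2, 3, 0, 1, 2, 3, 2]),
    ([0, 1, 2, 3, 2, 3, 1, 2, 0, 1, 2], [1, 0, 1, 2, 3, 2, 3, 1, 2, 0, 1]),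
    ([1, 2, 3, 2, 3, 1, 2, 3, 2, 3], [2, 1, 2, 3, 2, 3, 1, 2, 3, 2]),
    ([0, 1, 2, 3, 2, 3, 1, 0, 1], [1, 0, 1, 2, 3, 2, 3, 1, 0]),
    ([0, 1, 2, 3, 2, 3, 0], [1, 0, 1, 2, 3, 2, 3]),
    ([1, 2, 3, 2, 1, 2], [2, 1, 2, 3, 2, 1]),
    ([0, 1, 2, 3, 2, 0], [1, 0, 1, 2, 3, 2]),
    ([1, 2, 3, 1], [2, 1, 2, 3]),
    ([0, 1, 2, 3, 0], [1, 0, 1, 2, 3]),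
    ([0, 1, 2, 0], [1, 0, 1, 2])] ++ basicRules

/-- Critical pairs from which `rules` arises. -/
def criticalPairs : List (List (Fin 4) × List (Fin 4)) :=
  [([0, 1, 0], [2]), ([0, 1, 2, 0], [3]), ([1, 2, 1], [3]), ([0, 1, 2, 3, 0], [2]),
    ([1, 2, 3, 1], [2, 1]), ([0, 1, 2, 3, 2, 0], [3]), ([0, 1, 2, 3, 2, 3, 0], [1, 0]),
    ([1, 2, 3, 2, 1, 2], [3, 2, 3, 2]), ([0, 1, 2, 3, 2, 3, 1, 0, 1], [2, 1]),
    ([0, 1, 2, 3, 2, 3, 1, 2, 0, 1, 2], [3, 2, 3, 2])]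

theorem foldl_addCriticalPair_criticalPairs :
    criticalPairs.foldl addCriticalPair basicRules = rules := by
  decide +kernel

/-- The word `ω` in the simple reflections. -/
def omegaWord : List (Fin 4) :=
  [3, 2, 3, 2, 3, 1, 2, 3, 2, 3, 0, 1, 2, 3, 2, 3, 1, 2, 3, 2, 0, 1, 2, 3, 2, 3]

/-- Reduced words for the images of the simple reflections under `δ`. -/
def deltaWord : Fin 4 → List (Fin 4) :=
  let w := [2, 3, 2, 1, 2, 3, 2, 1, 0, 3, 2, 3, 1, 2]
  ![[0], w ++ 3 :: w.reverse, [2], [3, 2, 3]]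

/-- Reduced words for the images of the simple reflections under `δ ^ 2`. -/
def deltaSqWord : Fin 4 → List (Fin 4) :=
  ![[0], [2, 1, 0, 1, 2], [2], [2, 3, 2]]

theorem normalize_deltaWord_one :
    normalize rules (deltaWord 1) = normalize rules (omegaWord ++ 1 :: omegaWord.reverse) := by
  decide +kernel

theorem normalize_flatten_replicate_deltaWord (i j : Fin 4) :
    normalize rules (List.replicate (H₄ i j) (deltaWord i ++ deltaWord j)).flatten = [] := by
  revert i j
  decide +kernel

theorem normalize_flatMap_deltaWord_deltaWord (i : Fin 4) :
    normalize rules ((deltaWord i).flatMap deltaWord) = normalize rules (deltaSqWord i) := by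
  revert i
  decide +kernel

theorem normalize_flatMap_deltaSqWord_deltaSqWord (i : Fin 4) :
    normalize rules ((deltaSqWord i).flatMap deltaSqWord) = normalize rules [i] := by
  revert i
  decide +kernel

section CoxeterSystem

variable {W : Type*} [Group W] (cs : CoxeterSystem H₄ W)

theorem isSound_rules : IsSound cs.simple rules := by
  rw [← foldl_addCriticalPair_criticalPairs]
  refine IsSound.foldl_addCriticalPair ?_ _
  have sq (i : Fin 4) : ([i, i].map cs.simple).prod = (([] : List (Fin 4)).map cs.simple).prod := by
    simp
  have braid := cs.wordProd_braidWord_eq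
  simp only [IsSound, basicRules, List.forall_mem_cons]
  exact ⟨sq 0, sq 1, sq 2, sq 3, braid 1 0, braid 0 2, braid 0 3, braid 2 1, braid 1 3, braid 3 2,
    by simp⟩

theorem isLiftable_wordProd_deltaWord : H₄.IsLiftable fun i => cs.wordProd (deltaWord i) := by
  intro i j
  have h := (isSound_rules cs).prod_map_normalize
    (List.replicate (H₄ i j) (deltaWord i ++ deltaWord j)).flatten
  rw [normalize_flatten_replicate_deltaWord] at h
  simpa [List.map_flatten, List.prod_flatten, CoxeterSystem.wordProd] using h.symm

theorem map_wordProd_eq_wordProd {F : Fin 4 → List (Fin 4)} {φ : W →* W}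
    (hφ : ∀ i, φ (cs.simple i) = cs.wordProd (F i)) {v w : List (Fin 4)}
    (h : normalize rules (v.flatMap F) = normalize rules w) :
    φ (cs.wordProd v) = cs.wordProd w := by
  have h := (isSound_rules cs).prod_map_eq h
  rw [List.map_flatMap] at h
  simpa [CoxeterSystem.wordProd, map_list_prod, List.flatMap, List.prod_flatten,
    Function.comp_def, hφ] using h

/-- The endomorphism of a Coxeter group of type `H₄` given on simple reflections by `δ`. -/
noncomputable def deltaHom : W →* W :=
  cs.lift ⟨_, isLiftable_wordProd_deltaWord cs⟩

theorem deltaHom_simple (i : Fin 4) : deltaHom cs (cs.simple i) = cs.wordProd (deltaWord i) :=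
  cs.lift_apply_simple (isLiftable_wordProd_deltaWord cs) i

theorem deltaHom_pow_four : (deltaHom cs).comp ((deltaHom cs).comp
    ((deltaHom cs).comp (deltaHom cs))) = MonoidHom.id W := by
  have hsq (i : Fin 4) :
      (deltaHom cs).comp (deltaHom cs) (cs.simple i) = cs.wordProd (deltaSqWord i) := by
    rw [MonoidHom.comp_apply, deltaHom_simple]
    exact map_wordProd_eq_wordProd cs (deltaHom_simple cs)
      (normalize_flatMap_deltaWord_deltaWord i)
  refine cs.ext_simple fun i => ?_
  rw [← MonoidHom.comp_assoc, MonoidHom.comp_apply, hsq, MonoidHom.id_apply,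
    map_wordProd_eq_wordProd cs hsq (normalize_flatMap_deltaSqWord_deltaSqWord i),
    cs.wordProd_singleton]

/-- The automorphism of a Coxeter group of type `H₄` given on simple reflections by `δ`. -/
noncomputable def delta : W ≃* W :=
  (deltaHom cs).toMulEquiv ((deltaHom cs).comp ((deltaHom cs).comp (deltaHom cs)))
    (deltaHom_pow_four cs) (deltaHom_pow_four cs)

theorem delta_simple (i : Fin 4) : delta cs (cs.simple i) = cs.wordProd (deltaWord i) :=
  deltaHom_simple cs i

theorem delta_simple_one :
    delta cs (cs.simple 1) =
      cs.wordProd omegaWord * cs.simple 1 * (cs.wordProd omegaWord)⁻¹ := by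
  rw [delta_simple, ← cs.wordProd_reverse, mul_assoc, ← cs.wordProd_cons, ← cs.wordProd_append]
  exact (isSound_rules cs).prod_map_eq normalize_deltaWord_one

end CoxeterSystem

end CoxeterMatrix.H₄


/-- Let `(W,S)` be a Coxeter system of type `H₄`, `S = {r,s,t,u}` with
`o(rs) = 5`, `o(st) = 3`, `o(tu) = 3` and all other pairs commuting. The map
`δ : r ↦ rsr, s ↦ s, t ↦ ωtω⁻¹, u ↦ u` (where `ω = rsrsr·ω₂` and
`ω₂ = tsrsrutsrsrtsrsutsrsr`) extends to an automorphism of `W`; in particular `δ(S)` is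
a Coxeter generating set of `W` of type `H₄`. -/
theorem H4_delta_extends_to_automorphism {W : Type*} [Group W]
    (cs : CoxeterSystem CoxeterMatrix.H₄ W)
    (r s t u : W) (hr : r = cs.simple 3) (hs : s = cs.simple 2)
    (ht : t = cs.simple 1) (hu : u = cs.simple 0)
    (ω₂ ω : W)
    (hω₂ : ω₂ = t*s*r*s*r*u*t*s*r*s*r*t*s*r*s*u*t*s*r*s*r)
    (hω : ω = r*s*r*s*r*ω₂) :
    (∃ φ : W ≃* W, φ r = r*s*r ∧ φ s = s ∧ φ t = ω*t*ω⁻¹ ∧ φ u = u) ∧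
    (∃ cs' : CoxeterSystem CoxeterMatrix.H₄ W,
      cs'.simple 3 = r*s*r ∧ cs'.simple 2 = s ∧
      cs'.simple 1 = ω*t*ω⁻¹ ∧ cs'.simple 0 = u) := by
  have h0 : CoxeterMatrix.H₄.delta cs u = u := by
    rw [hu, CoxeterMatrix.H₄.delta_simple]
    simp [CoxeterMatrix.H₄.deltaWord]
  have h1 : CoxeterMatrix.H₄.delta cs t = ω * t * ω⁻¹ := by
    rw [ht, CoxeterMatrix.H₄.delta_simple_one, hω, hω₂, hr, hs, ht, hu]
    simp [CoxeterMatrix.H₄.omegaWord, CoxeterSystem.wordProd, mul_assoc]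
  have h2 : CoxeterMatrix.H₄.delta cs s = s := by
    rw [hs, CoxeterMatrix.H₄.delta_simple]
    simp [CoxeterMatrix.H₄.deltaWord]
  have h3 : CoxeterMatrix.H₄.delta cs r = r * s * r := by
    rw [hr, hs, CoxeterMatrix.H₄.delta_simple]
    simp [CoxeterMatrix.H₄.deltaWord, CoxeterSystem.wordProd, mul_assoc]
  refine ⟨⟨CoxeterMatrix.H₄.delta cs, h3, h2, h1, h0⟩, cs.map (CoxeterMatrix.H₄.delta cs), ?_⟩
  simp only [CoxeterSystem.map_simple, ← hr, ← hs, ← ht, ← hu]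
  exact ⟨h3, h2, h1, h0⟩
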